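/- arXiv:2101.06192 — 5 statements merged into one kernel-verified Lean document; each statement's English description precedes it below -/
import Mathlib

section
/- For every pair of vertices u, v ∈ V of G, the forest distance f_α(u, v) in G equals the effective resistance between u and v in the augmented graph G_star; that is, for any vector x solving L_star x = e_u − e_v one has (e_u − e_v)^T x = (e_u − e_v)^T (αL + I)^{-1} (e_u − e_v). -/
open Matrix

variable {V : Type*} [Fintype V] [DecidableEq V]

/-- The weighted Laplacian matrix `L = D - W` of a weighted graph given by its
(symmetric, nonnegative, zero-diagonal) weight matrix `W`. -/
def lap (W : Matrix V V ℝ) : Matrix V V ℝ :=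
  Matrix.diagonal (fun v => ∑ u, W v u) - W

/-- The forest distance `f_α(u,v) = (e_u - e_v)ᵀ (αL + I)⁻¹ (e_u - e_v)`. -/
noncomputable def forestDist (α : ℝ) (W : Matrix V V ℝ) (u v : V) : ℝ :=
  (Pi.single u 1 - Pi.single v 1) ⬝ᵥ ((α • lap W + 1)⁻¹ *ᵥ (Pi.single u 1 - Pi.single v 1))

/-- The Laplacian of the augmented graph `G_star`: the `V × V` block equals `αL + I`,
the new universal vertex `none` has diagonal entry `n` and off-diagonal entries `-1`. -/
noncomputable def lapStar (α : ℝ) (W : Matrix V V ℝ) : Matrix (Option V) (Option V) ℝ :=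
  Matrix.of fun i j =>
    match i, j with
    | none, none => (Fintype.card V : ℝ)
    | none, some _ => -1
    | some _, none => -1
    | some u, some v => (α • lap W + 1) u v

lemma lap_mulVec_one (W : Matrix V V ℝ) : lap W *ᵥ 1 = 0 := by
  ext i
  simp [lap, mulVec, dotProduct, diagonal_apply]

/-- `αL + I` is strictly diagonally dominant, hence invertible. -/
lemma isUnit_det_smul_lap_add_one (W : Matrix V V ℝ) (hnn : ∀ u v, 0 ≤ W u v)
    (hdiag : ∀ v, W v v = 0) (α : ℝ) (hα : 0 < α) :
    IsUnit (α • lap W + 1).det := by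
  refine isUnit_iff_ne_zero.mpr (det_ne_zero_of_sum_row_lt_diag fun k => ?_)
  have hoff : ∑ j ∈ Finset.univ.erase k, ‖(α • lap W + 1) k j‖ = α * ∑ j, W k j := by
    rw [← Finset.add_sum_erase _ (W k) (Finset.mem_univ k), hdiag, zero_add, Finset.mul_sum]
    refine Finset.sum_congr rfl fun j hj => ?_
    have hkj : k ≠ j := (Finset.ne_of_mem_erase hj).symm
    simp [lap, hkj, abs_of_nonneg (hnn k j), abs_of_pos hα]
  have hon : (α • lap W + 1) k k = α * ∑ j, W k j + 1 := by
    simp [lap, hdiag]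
  rw [hoff, hon]
  exact (lt_add_one _).trans_le (le_abs_self _)

/-- Grounding a potential on the augmented graph at the universal vertex reduces `L_star` to
`αL + I`. -/
lemma smul_lap_add_one_mulVec_grounded (α : ℝ) (W : Matrix V V ℝ) (x : Option V → ℝ) :
    (α • lap W + 1) *ᵥ (fun i => x (some i) - x none) =
      fun i => (lapStar α W *ᵥ x) (some i) := by
  have hsplit : (fun i => x (some i) - x none) = (fun i => x (some i)) - x none • (1 : V → ℝ) := by
    ext i
    simp
  have hone : (α • lap W + 1) *ᵥ (1 : V → ℝ) = 1 := by
    rw [add_mulVec, smul_mulVec, lap_mulVec_one, smul_zero, zero_add, one_mulVec]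
  rw [hsplit, mulVec_sub, mulVec_smul, hone]
  ext i
  simp only [Pi.sub_apply, Pi.smul_apply, Pi.one_apply, smul_eq_mul, mul_one, mulVec, dotProduct,
    Fintype.sum_option, lapStar, of_apply]
  ring

/-- for every pair of vertices `u, v` of `G`, the forest distance `f_α(u,v)`
equals the effective resistance between `u` and `v` in the augmented graph `G_star`:
for any `x` solving `L_star x = e_u - e_v` one has
`(e_u - e_v)ᵀ x = (e_u - e_v)ᵀ (αL + I)⁻¹ (e_u - e_v)`. -/
theorem forestDist_eq_effectiveResistance_in_augmented
    (W : Matrix V V ℝ) (hsym : ∀ u v, W u v = W v u) (hnn : ∀ u v, 0 ≤ W u v)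
    (hdiag : ∀ v, W v v = 0) (α : ℝ) (hα : 0 < α) (u v : V)
    (x : Option V → ℝ)
    (hx : lapStar α W *ᵥ x = Pi.single (some u) 1 - Pi.single (some v) 1) :
    (Pi.single (some u) 1 - Pi.single (some v) 1) ⬝ᵥ x = forestDist α W u v := by
  have hgrounded : (α • lap W + 1) *ᵥ (fun i => x (some i) - x none) =
      Pi.single u 1 - Pi.single v 1 := by
    rw [smul_lap_add_one_mulVec_grounded, hx]
    ext i
    simp [Pi.single_apply]
  rw [forestDist, ← hgrounded, mulVec_mulVec,
    nonsing_inv_mul _ (isUnit_det_smul_lap_add_one W hnn hdiag α hα), one_mulVec, hgrounded]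
  simp [sub_dotProduct]
end

section
/- The forest matrix Ω = (αL + I)^{-1} is symmetric and doubly stochastic: every entry of Ω lies in the interval [0, 1] and every row (and column) of Ω sums to 1; in particular Ω[v, v] = 1 − ∑_{w ≠ v} Ω[v, w] for every vertex v. -/
open Matrix

variable {V : Type*} [Fintype V] [DecidableEq V]

theorem smul_lap_add_one_mulVec (W : Matrix V V ℝ) (α : ℝ) (x : V → ℝ) (v : V) :
    ((α • lap W + 1) *ᵥ x) v = x v + α * ∑ u, W v u * (x v - x u) := by
  simp only [lap, add_mulVec, smul_mulVec, sub_mulVec, one_mulVec, Pi.add_apply, Pi.smul_apply,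
    Pi.sub_apply, mulVec_diagonal, smul_eq_mul, mul_sub, Finset.sum_sub_distrib, Finset.sum_mul]
  simp only [mulVec, dotProduct]
  ring

/-- The minimum principle for `αL + I`. -/
theorem nonneg_of_smul_lap_add_one_mulVec_nonneg {W : Matrix V V ℝ} (hnn : ∀ u v, 0 ≤ W u v)
    {α : ℝ} (hα : 0 ≤ α) {x : V → ℝ} (hx : 0 ≤ (α • lap W + 1) *ᵥ x) : 0 ≤ x := by
  intro v
  have : Nonempty V := ⟨v⟩
  obtain ⟨m, hm⟩ := Finite.exists_min x
  have h := hx m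
  rw [smul_lap_add_one_mulVec] at h
  have hsum : ∑ u, W m u * (x m - x u) ≤ 0 :=
    Finset.sum_nonpos fun u _ => mul_nonpos_of_nonneg_of_nonpos (hnn m u) (sub_nonpos.2 (hm u))
  have hmul := mul_nonpos_of_nonneg_of_nonpos hα hsum
  have hmv := hm v
  simp only [Pi.zero_apply] at h ⊢
  linarith

theorem isUnit_smul_lap_add_one {W : Matrix V V ℝ} (hnn : ∀ u v, 0 ≤ W u v)
    {α : ℝ} (hα : 0 ≤ α) : IsUnit (α • lap W + 1) := by
  rw [← mulVec_injective_iff_isUnit]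
  intro x y hxy
  apply le_antisymm
  · rw [← sub_nonneg]
    apply nonneg_of_smul_lap_add_one_mulVec_nonneg hnn hα
    rw [mulVec_sub, sub_nonneg]
    exact hxy.le
  · rw [← sub_nonneg]
    apply nonneg_of_smul_lap_add_one_mulVec_nonneg hnn hα
    rw [mulVec_sub, sub_nonneg]
    exact hxy.ge

theorem inv_smul_lap_add_one_nonneg {W : Matrix V V ℝ} (hnn : ∀ u v, 0 ≤ W u v)
    {α : ℝ} (hα : 0 ≤ α) (u v : V) : 0 ≤ (α • lap W + 1)⁻¹ u v := by
  have hdet := (isUnit_iff_isUnit_det _).1 (isUnit_smul_lap_add_one hnn hα)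
  have h := nonneg_of_smul_lap_add_one_mulVec_nonneg hnn hα
    (x := (α • lap W + 1)⁻¹ *ᵥ Pi.single v 1) (by
      rw [mulVec_mulVec, mul_nonsing_inv _ hdet, one_mulVec]
      exact Pi.single_nonneg.2 zero_le_one) u
  simpa using h

theorem sum_inv_smul_lap_add_one {W : Matrix V V ℝ} (hnn : ∀ u v, 0 ≤ W u v)
    {α : ℝ} (hα : 0 ≤ α) (v : V) : ∑ w, (α • lap W + 1)⁻¹ v w = 1 := by
  have hdet := (isUnit_iff_isUnit_det _).1 (isUnit_smul_lap_add_one hnn hα)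
  have hone : (α • lap W + 1) *ᵥ (1 : V → ℝ) = 1 := by
    ext v
    simp [smul_lap_add_one_mulVec]
  have h : (α • lap W + 1)⁻¹ *ᵥ (1 : V → ℝ) = 1 := by
    conv_lhs => rw [← hone, mulVec_mulVec, nonsing_inv_mul _ hdet, one_mulVec]
  simpa [mulVec, dotProduct] using congrFun h v

theorem lap_isSymm {W : Matrix V V ℝ} (hsym : W.IsSymm) : (lap W).IsSymm :=
  (isSymm_diagonal _).sub hsym

/-- the forest matrix `Ω = (αL + I)⁻¹` is symmetric and doubly stochastic:
every entry lies in `[0,1]`, every row and every column sums to `1`, and in particular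
`Ω[v,v] = 1 - ∑_{w ≠ v} Ω[v,w]` for every vertex `v`. -/
theorem forestMatrix_symm_doublyStochastic
    (W : Matrix V V ℝ) (hsym : ∀ u v, W u v = W v u) (hnn : ∀ u v, 0 ≤ W u v)
    (hdiag : ∀ v, W v v = 0) (α : ℝ) (hα : 0 < α) :
    ((α • lap W + 1)⁻¹).IsSymm ∧
    (∀ u v : V, 0 ≤ (α • lap W + 1)⁻¹ u v ∧ (α • lap W + 1)⁻¹ u v ≤ 1) ∧
    (∀ v : V, ∑ w, (α • lap W + 1)⁻¹ v w = 1) ∧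
    (∀ v : V, ∑ w, (α • lap W + 1)⁻¹ w v = 1) ∧
    (∀ v : V, (α • lap W + 1)⁻¹ v v = 1 - ∑ w ∈ Finset.univ.erase v, (α • lap W + 1)⁻¹ v w) := by
  have hnonneg := inv_smul_lap_add_one_nonneg hnn hα.le
  have hrow := sum_inv_smul_lap_add_one hnn hα.le
  have hS : ((α • lap W + 1)⁻¹).IsSymm := by
    rw [IsSymm, transpose_nonsing_inv,
      (((lap_isSymm (IsSymm.ext fun u v => hsym v u)).smul α).add isSymm_one).eq]
  refine ⟨hS, fun u v => ⟨hnonneg u v, ?_⟩, hrow, fun v => ?_, fun v => ?_⟩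
  · rw [← hrow u]
    exact Finset.single_le_sum (fun w _ => hnonneg u w) (Finset.mem_univ v)
  · rw [← hrow v]
    exact Finset.sum_congr rfl fun w _ => hS.apply v w
  · rw [eq_sub_iff_add_eq, Finset.add_sum_erase _ _ (Finset.mem_univ v), hrow v]
end

section
/- The forest distance f_α is a metric on the vertex set V: for all u, v, w ∈ V one has f_α(u, v) ≥ 0 with f_α(u, v) = 0 if and only if u = v, f_α(u, v) = f_α(v, u), and f_α(u, w) ≤ f_α(u, v) + f_α(v, w). -/
open Matrix

variable {V : Type*} [Fintype V] [DecidableEq V]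

lemma lap_mulVec_apply (W : Matrix V V ℝ) (x : V → ℝ) (i : V) :
    (lap W *ᵥ x) i = ∑ j, W i j * (x i - x j) := by
  rw [lap, Matrix.sub_mulVec, Pi.sub_apply, Matrix.mulVec_diagonal]
  simp only [mul_sub, Finset.sum_sub_distrib, Finset.sum_mul, Matrix.mulVec, dotProduct]

lemma sum_lap_mulVec (W : Matrix V V ℝ) (hsym : ∀ u v, W u v = W v u) (x : V → ℝ) :
    ∑ i, (lap W *ᵥ x) i = 0 := by
  simp only [lap_mulVec_apply, mul_sub, Finset.sum_sub_distrib]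
  rw [sub_eq_zero, Finset.sum_comm]
  exact Finset.sum_congr rfl fun i _ => Finset.sum_congr rfl fun j _ => by rw [hsym]

/-- The quadratic form of the Laplacian is the Dirichlet energy. -/
lemma two_mul_dotProduct_lap_mulVec (W : Matrix V V ℝ) (hsym : ∀ u v, W u v = W v u)
    (x : V → ℝ) :
    2 * (x ⬝ᵥ (lap W *ᵥ x)) = ∑ i, ∑ j, W i j * (x i - x j) ^ 2 := by
  have h₁ : x ⬝ᵥ (lap W *ᵥ x) = ∑ i, ∑ j, x i * (W i j * (x i - x j)) := by
    simp only [dotProduct, lap_mulVec_apply, Finset.mul_sum]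
  have h₂ : x ⬝ᵥ (lap W *ᵥ x) = ∑ i, ∑ j, x j * (W i j * (x j - x i)) := by
    rw [h₁, Finset.sum_comm]
    exact Finset.sum_congr rfl fun i _ => Finset.sum_congr rfl fun j _ => by rw [hsym]
  rw [two_mul]
  nth_rewrite 1 [h₁]
  rw [h₂, ← Finset.sum_add_distrib]
  refine Finset.sum_congr rfl fun i _ => ?_
  rw [← Finset.sum_add_distrib]
  exact Finset.sum_congr rfl fun j _ => by ring

lemma posSemidef_lap (W : Matrix V V ℝ) (hsym : ∀ u v, W u v = W v u)
    (hnn : ∀ u v, 0 ≤ W u v) : (lap W).PosSemidef := by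
  refine Matrix.PosSemidef.of_dotProduct_mulVec_nonneg ?_ fun x => ?_
  · have hW : W.IsHermitian := Matrix.IsHermitian.ext fun i j => by simp [hsym i j]
    exact (Matrix.isHermitian_diagonal _).sub hW
  · have h : 0 ≤ ∑ i, ∑ j, W i j * (x i - x j) ^ 2 :=
      Finset.sum_nonneg fun i _ => Finset.sum_nonneg fun j _ =>
        mul_nonneg (hnn i j) (sq_nonneg _)
    rw [← two_mul_dotProduct_lap_mulVec W hsym] at h
    simpa using h

lemma posDef_smul_lap_add_one (W : Matrix V V ℝ) (hsym : ∀ u v, W u v = W v u)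
    (hnn : ∀ u v, 0 ≤ W u v) {α : ℝ} (hα : 0 ≤ α) : (α • lap W + 1).PosDef :=
  Matrix.PosDef.posSemidef_add ((posSemidef_lap W hsym hnn).smul hα) Matrix.PosDef.one

/-- Maximum principle: a solution of `(αL + I) x = e_v - e_w` attains its maximum at `v`. -/
lemma apply_le_of_smul_lap_add_one_mulVec_eq (W : Matrix V V ℝ)
    (hsym : ∀ u v, W u v = W v u) (hnn : ∀ u v, 0 ≤ W u v) {α : ℝ} (hα : 0 ≤ α) (v w : V)
    (x : V → ℝ) (hx : (α • lap W + 1) *ᵥ x = Pi.single v 1 - Pi.single w 1) (u : V) :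
    x u ≤ x v := by
  have hx' : ∀ i, α * (lap W *ᵥ x) i + x i =
      (Pi.single v 1 : V → ℝ) i - (Pi.single w 1 : V → ℝ) i := fun i => by
    simpa [Matrix.add_mulVec, Matrix.smul_mulVec] using congrFun hx i
  have hsum : ∑ i, x i = 0 := by
    have h := Finset.sum_congr (rfl : Finset.univ = Finset.univ) fun i (_ : i ∈ _) => hx' i
    rw [Finset.sum_add_distrib, ← Finset.mul_sum, sum_lap_mulVec W hsym] at h
    simpa using h
  have : Nonempty V := ⟨v⟩
  obtain ⟨i, hi⟩ := Finite.exists_max x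
  by_cases hiv : i = v
  · exact hiv ▸ hi u
  have hlap : 0 ≤ (lap W *ᵥ x) i := by
    rw [lap_mulVec_apply]
    exact Finset.sum_nonneg fun j _ => mul_nonneg (hnn i j) (sub_nonneg.2 (hi j))
  have hxi : x i ≤ 0 := by
    have hw : 0 ≤ (Pi.single w 1 : V → ℝ) i := by
      rw [Pi.single_apply]; split_ifs <;> norm_num
    have hv : (Pi.single v 1 : V → ℝ) i = 0 := Pi.single_eq_of_ne hiv _
    linarith [hx' i, mul_nonneg hα hlap]
  have hzero := (Finset.sum_eq_zero_iff_of_nonpos fun j _ => (hi j).trans hxi).1 hsum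
  rw [hzero u (Finset.mem_univ u), hzero v (Finset.mem_univ v)]

/-- the forest distance `f_α` is a metric on the vertex set: it is nonnegative,
vanishes exactly on the diagonal, is symmetric, and satisfies the triangle inequality. -/
theorem forestDist_isMetric
    (W : Matrix V V ℝ) (hsym : ∀ u v, W u v = W v u) (hnn : ∀ u v, 0 ≤ W u v)
    (hdiag : ∀ v, W v v = 0) (α : ℝ) (hα : 0 < α) :
    ∀ u v w : V,
      0 ≤ forestDist α W u v ∧
      (forestDist α W u v = 0 ↔ u = v) ∧
      forestDist α W u v = forestDist α W v u ∧
      forestDist α W u w ≤ forestDist α W u v + forestDist α W v w := by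
  intro u v w
  have hM := posDef_smul_lap_add_one W hsym hnn hα.le
  have hΩ := hM.inv
  refine ⟨?_, ⟨fun h => ?_, ?_⟩, ?_, ?_⟩
  · have hnonneg := hΩ.posSemidef.dotProduct_mulVec_nonneg (Pi.single u 1 - Pi.single v 1)
    rwa [star_trivial] at hnonneg
  · by_contra huv
    have hne : (Pi.single u 1 - Pi.single v 1 : V → ℝ) ≠ 0 := fun h0 => by
      simpa [huv] using congrFun h0 u
    have hpos := hΩ.dotProduct_mulVec_pos hne
    rw [star_trivial] at hpos
    exact hpos.ne' h
  · rintro rfl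
    simp [forestDist]
  · unfold forestDist
    rw [← neg_sub (Pi.single v 1 : V → ℝ), Matrix.mulVec_neg, neg_dotProduct_neg]
  · set Ω := (α • lap W + 1)⁻¹ with hΩdef
    have hcancel : (α • lap W + 1) *ᵥ (Ω *ᵥ (Pi.single v 1 - Pi.single w 1)) =
        Pi.single v 1 - Pi.single w 1 := by
      rw [Matrix.mulVec_mulVec, Matrix.mul_nonsing_inv _
        ((Matrix.isUnit_iff_isUnit_det _).1 hM.isUnit), Matrix.one_mulVec]
    have hmax := apply_le_of_smul_lap_add_one_mulVec_eq W hsym hnn hα.le v w _ hcancel u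
    have hΩT : Ωᵀ = Ω := by simpa using hΩ.isHermitian.eq
    have hcomm : (Pi.single v 1 - Pi.single w 1) ⬝ᵥ (Ω *ᵥ (Pi.single u 1 - Pi.single v 1)) =
        (Pi.single u 1 - Pi.single v 1) ⬝ᵥ (Ω *ᵥ (Pi.single v 1 - Pi.single w 1)) := by
      rw [Matrix.dotProduct_mulVec, ← Matrix.mulVec_transpose, hΩT, dotProduct_comm]
    have hcross : (Pi.single u 1 - Pi.single v 1) ⬝ᵥ
        (Ω *ᵥ (Pi.single v 1 - Pi.single w 1)) ≤ 0 := by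
      rw [sub_dotProduct, single_one_dotProduct, single_one_dotProduct]
      exact sub_nonpos.2 hmax
    unfold forestDist
    rw [← hΩdef, ← sub_add_sub_cancel (Pi.single u 1 : V → ℝ) (Pi.single v 1),
      Matrix.mulVec_add, add_dotProduct, dotProduct_add, dotProduct_add, hcomm]
    linarith
end

section
/- Let G be a connected unweighted 3-regular simple graph on n vertices, let L_star be the Laplacian of the augmented graph G_star (with α = 1), and let S ⊂ V be a nonempty subset with |S| = k. Then trace((L_star_{−S})^{-1}) ≥ 4/(3n + k) + (1/4 + 1/(4(3n + k)))·(n − k), and equality holds if and only if S is a vertex cover of G. -/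
open Matrix

variable {V : Type*} [Fintype V] [DecidableEq V]

/-- The Laplacian of the augmented graph `G_star` of a simple graph `G` (with `α = 1`):
the `V × V` block equals `L + I`, the new universal vertex `none` has diagonal entry
`n` and off-diagonal entries `-1`. -/
def lapStarSG (G : SimpleGraph V) [DecidableRel G.Adj] :
    Matrix (Option V) (Option V) ℝ :=
  Matrix.of fun i j =>
    match i, j with
    | none, none => (Fintype.card V : ℝ)
    | none, some _ => -1
    | some _, none => -1
    | some u, some v => (G.lapMatrix ℝ + 1) u v

section PerturbedInverse

variable {ι : Type*} [Fintype ι]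

/-- Second order resolvent expansion of the inverse of `N - E`. -/
theorem inv_sub_eq_add_mul_mul [DecidableEq ι] {N X E : Matrix ι ι ℝ} (hNX : N * X = 1)
    (hdet : IsUnit (N - E).det) :
    (N - E)⁻¹ = X + X * E * X + X * E * (N - E)⁻¹ * E * X := by
  have hXN : X * N = 1 := mul_eq_one_comm.mp hNX
  set Y := (N - E)⁻¹
  have hY : (N - E) * Y = 1 := mul_nonsing_inv _ hdet
  have hY' : Y * (N - E) = 1 := nonsing_inv_mul _ hdet
  have hleft : Y = X + X * E * Y := by
    calc Y = X * N * Y := by rw [hXN, one_mul]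
      _ = X * ((N - E) * Y) + X * E * Y := by noncomm_ring
      _ = X + X * E * Y := by rw [hY, mul_one]
  have hright : Y = X + Y * E * X := by
    calc Y = Y * (N * X) := by rw [hNX, mul_one]
      _ = (Y * (N - E)) * X + Y * E * X := by noncomm_ring
      _ = X + Y * E * X := by rw [hY', one_mul]
  calc Y = X + X * E * Y := hleft
    _ = X + X * E * (X + Y * E * X) := by rw [← hright]
    _ = X + X * E * X + X * E * Y * E * X := by noncomm_ring

theorem trace_add_trace_le_trace_inv_sub [DecidableEq ι] {N X E : Matrix ι ι ℝ}
    (hNX : N * X = 1) (hX : X.IsSymm) (hE : E.IsSymm) (hpos : (N - E).PosDef) :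
    X.trace + (X * E * X).trace ≤ (N - E)⁻¹.trace := by
  have hpsd : (X * E * (N - E)⁻¹ * E * X).PosSemidef := by
    have h := hpos.inv.posSemidef.mul_mul_conjTranspose_same (X * E)
    rwa [conjTranspose_eq_transpose_of_trivial, transpose_mul, hX.eq, hE.eq,
      ← mul_assoc (X * E * (N - E)⁻¹)] at h
  have h := congrArg trace (inv_sub_eq_add_mul_mul hNX hpos.det_pos.ne'.isUnit)
  rw [trace_add, trace_add] at h
  linarith [hpsd.trace_nonneg]

theorem trace_mul_mul_nonneg {X E : Matrix ι ι ℝ} (hX : ∀ i j, 0 < X i j)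
    (hE : ∀ i j, 0 ≤ E i j) : 0 ≤ (X * E * X).trace := by
  simp only [trace, diag_apply, mul_apply]
  exact Finset.sum_nonneg fun i _ => Finset.sum_nonneg fun j _ =>
    mul_nonneg (Finset.sum_nonneg fun k _ => mul_nonneg (hX _ _).le (hE _ _)) (hX _ _).le

/-- If `X` is entrywise positive and `E` entrywise nonnegative, then the trace of `X * E * X`
only vanishes when `E` does. -/
theorem eq_zero_of_trace_mul_mul_nonpos {X E : Matrix ι ι ℝ} (hX : ∀ i j, 0 < X i j)
    (hE : ∀ i j, 0 ≤ E i j) (h : (X * E * X).trace ≤ 0) : E = 0 := by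
  by_contra hne
  obtain ⟨a, b, hab⟩ : ∃ a b, E a b ≠ 0 := by
    by_contra! h0
    exact hne (Matrix.ext h0)
  refine h.not_gt ?_
  have hinner : ∀ i j, 0 ≤ (X * E) i j := fun i j => by
    rw [mul_apply]
    exact Finset.sum_nonneg fun k _ => mul_nonneg (hX _ _).le (hE _ _)
  have hrow : 0 < (X * E) b b := by
    rw [mul_apply]
    exact Finset.sum_pos' (fun k _ => mul_nonneg (hX _ _).le (hE _ _))
      ⟨a, Finset.mem_univ _, mul_pos (hX _ _) ((hE a b).lt_of_ne' hab)⟩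
  have hdiag : ∀ i, 0 ≤ (X * E * X) i i := fun i => by
    rw [mul_apply]
    exact Finset.sum_nonneg fun k _ => mul_nonneg (hinner _ _) (hX _ _).le
  refine Finset.sum_pos' (fun i _ => hdiag i) ⟨b, Finset.mem_univ _, ?_⟩
  rw [diag_apply, mul_apply]
  exact Finset.sum_pos' (fun k _ => mul_nonneg (hinner _ _) (hX _ _).le)
    ⟨b, Finset.mem_univ _, mul_pos hrow (hX _ _)⟩

/-- The quadratic form of a nonnegative symmetric matrix is bounded by its row sums. -/
theorem sum_mul_mul_le_of_row_sum_le {A : Matrix ι ι ℝ} (hA : A.IsSymm)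
    (hA0 : ∀ i j, 0 ≤ A i j) {d : ℝ} (hd : ∀ i, ∑ j, A i j ≤ d) (y : ι → ℝ) :
    ∑ i, ∑ j, A i j * (y i * y j) ≤ d * ∑ i, y i ^ 2 := by
  have hsq : 0 ≤ ∑ i, ∑ j, A i j * (y i - y j) ^ 2 :=
    Finset.sum_nonneg fun i _ => Finset.sum_nonneg fun j _ => mul_nonneg (hA0 i j) (sq_nonneg _)
  have hswap : ∑ i, ∑ j, A i j * y j ^ 2 = ∑ i, ∑ j, A i j * y i ^ 2 := by
    rw [Finset.sum_comm]
    exact Finset.sum_congr rfl fun i _ => Finset.sum_congr rfl fun j _ => by rw [hA.apply]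
  have hexp : ∑ i, ∑ j, A i j * (y i - y j) ^ 2 =
      ∑ i, ∑ j, A i j * y i ^ 2 + ∑ i, ∑ j, A i j * y j ^ 2
        - 2 * ∑ i, ∑ j, A i j * (y i * y j) := by
    simp only [Finset.mul_sum, ← Finset.sum_add_distrib, ← Finset.sum_sub_distrib]
    exact Finset.sum_congr rfl fun i _ => Finset.sum_congr rfl fun j _ => by ring
  have hrow : ∑ i, ∑ j, A i j * y i ^ 2 ≤ d * ∑ i, y i ^ 2 := by
    rw [Finset.mul_sum]
    refine Finset.sum_le_sum fun i _ => ?_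
    rw [← Finset.sum_mul]
    exact mul_le_mul_of_nonneg_right (hd i) (sq_nonneg _)
  linarith

end PerturbedInverse

section StarMatrix

variable {W : Type*}

/-- The matrix `A` extended by zero to the extra index `none`. -/
def extendByZero (A : Matrix W W ℝ) : Matrix (Option W) (Option W) ℝ :=
  Matrix.of fun i j =>
    match i, j with
    | some u, some v => A u v
    | _, _ => 0

theorem extendByZero_isSymm {A : Matrix W W ℝ} (hA : A.IsSymm) : (extendByZero A).IsSymm := by
  refine IsSymm.ext fun i j => ?_
  rcases i with _ | u <;> rcases j with _ | v <;> simp [extendByZero, hA.apply]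

variable [DecidableEq W]

/-- The matrix of a star centred at `none`, with diagonal `a` at the centre and `4` at the leaves. -/
def starMatrix (a : ℝ) : Matrix (Option W) (Option W) ℝ :=
  Matrix.of fun i j =>
    match i, j with
    | none, none => a
    | none, some _ => -1
    | some _, none => -1
    | some u, some v => if u = v then 4 else 0

/-- The inverse of `starMatrix a`, where `c` is its entry at the centre. -/
noncomputable def starMatrixInv (c : ℝ) : Matrix (Option W) (Option W) ℝ :=
  Matrix.of fun i j =>
    match i, j with
    | none, none => c
    | none, some _ => c / 4
    | some _, none => c / 4
    | some u, some v => (if u = v then 1 / 4 else 0) + c / 16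

theorem starMatrixInv_pos {c : ℝ} (hc : 0 < c) (i j : Option W) :
    0 < starMatrixInv c i j := by
  rcases i with _ | u <;> rcases j with _ | v <;> simp only [starMatrixInv, of_apply]
  · exact hc
  · positivity
  · positivity
  · split_ifs <;> positivity

theorem starMatrixInv_isSymm (c : ℝ) : (starMatrixInv c : Matrix (Option W) _ ℝ).IsSymm := by
  refine IsSymm.ext fun i j => ?_
  rcases i with _ | u <;> rcases j with _ | v <;> simp [starMatrixInv, eq_comm]

variable [Fintype W]

theorem starMatrix_mul_starMatrixInv {a c : ℝ}
    (h : c * (a - (Fintype.card W : ℝ) / 4) = 1) :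
    (starMatrix a : Matrix (Option W) _ ℝ) * starMatrixInv c = 1 := by
  ext i j
  rcases i with _ | u <;> rcases j with _ | v <;>
    simp [mul_apply, Fintype.sum_option, starMatrix, starMatrixInv, one_apply,
      Finset.sum_add_distrib]
  · linarith
  · linarith
  · ring
  · split_ifs <;> ring

theorem trace_starMatrixInv (c : ℝ) :
    (starMatrixInv c : Matrix (Option W) _ ℝ).trace
      = c + (Fintype.card W : ℝ) * (1 / 4 + c / 16) := by
  simp [trace, Fintype.sum_option, starMatrixInv, mul_add]

theorem posDef_starMatrix_sub_extendByZero {A : Matrix W W ℝ} (hA : A.IsSymm)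
    (hA0 : ∀ i j, 0 ≤ A i j) (hd : ∀ i, ∑ j, A i j ≤ 3) {a : ℝ}
    (ha : (Fintype.card W : ℝ) < a) :
    (starMatrix a - extendByZero A).PosDef := by
  have hsymm : (starMatrix a - extendByZero A).IsSymm := by
    refine IsSymm.sub (IsSymm.ext fun i j => ?_) (extendByZero_isSymm hA)
    rcases i with _ | u <;> rcases j with _ | v <;> simp [starMatrix, eq_comm]
  refine PosDef.of_dotProduct_mulVec_pos
    (by rw [IsHermitian, conjTranspose_eq_transpose_of_trivial]; exact hsymm) fun x hx => ?_
  have hform : star x ⬝ᵥ ((starMatrix a - extendByZero A) *ᵥ x) =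
      (a - Fintype.card W) * x none ^ 2 + ∑ w, (x none - x (some w)) ^ 2
        + (3 * ∑ w, x (some w) ^ 2 - ∑ u, ∑ v, A u v * (x (some u) * x (some v))) := by
    have hsq : ∑ w, (x none - x (some w)) ^ 2 = Fintype.card W * x none ^ 2
        - 2 * x none * ∑ w, x (some w) + ∑ w, x (some w) ^ 2 := by
      simp [sub_sq, Finset.sum_add_distrib, Finset.sum_sub_distrib, Finset.mul_sum]
    have hleaf : ∀ u, x (some u) * (-x none + 4 * x (some u) - ∑ v, A u v * x (some v))
        = -x none * x (some u) + 4 * x (some u) ^ 2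
          - ∑ v, A u v * (x (some u) * x (some v)) := fun u => by
      simp only [mul_left_comm (A u _), ← Finset.mul_sum]
      ring
    have hsum : ∑ u, x (some u) * (-x none + 4 * x (some u) - ∑ v, A u v * x (some v))
        = -x none * ∑ u, x (some u) + 4 * ∑ u, x (some u) ^ 2
          - ∑ u, ∑ v, A u v * (x (some u) * x (some v)) := by
      simp only [hleaf, Finset.sum_sub_distrib, Finset.sum_add_distrib, Finset.mul_sum]
    rw [hsq]
    simp only [dotProduct, mulVec, Fintype.sum_option, starMatrix, extendByZero, Matrix.sub_apply,
      of_apply, sub_mul, Finset.sum_sub_distrib, star_trivial, sub_zero, ite_mul, zero_mul,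
      neg_one_mul, Finset.sum_neg_distrib, Finset.sum_ite_eq, Finset.mem_univ, if_true,
      Finset.sum_const_zero, zero_add, hsum]
    ring
  have hA' := sum_mul_mul_le_of_row_sum_le hA hA0 hd fun w => x (some w)
  have hsum : 0 ≤ ∑ w, (x none - x (some w)) ^ 2 := Finset.sum_nonneg fun w _ => sq_nonneg _
  have ha' : 0 < a - Fintype.card W := sub_pos.mpr ha
  rw [hform]
  by_cases h0 : x none = 0
  · obtain ⟨w, hw⟩ : ∃ w, x (some w) ≠ 0 := by
      by_contra! h
      exact hx (funext fun i => by rcases i with _ | w; exacts [h0, h w])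
    have : 0 < ∑ w, (x none - x (some w)) ^ 2 :=
      Finset.sum_pos' (fun w _ => sq_nonneg _)
        ⟨w, Finset.mem_univ _, by rw [h0, zero_sub, neg_sq]; positivity⟩
    have := mul_nonneg ha'.le (sq_nonneg (x none))
    linarith
  · have : 0 < (a - Fintype.card W) * x none ^ 2 := by positivity
    linarith

end StarMatrix

section Grounded

/-- The indices left after deleting `S` from `Option V`, with `none` split off. -/
def optionNotMemEquiv (S : Finset V) :
    Option {v : V // v ∉ S} ≃ {x : Option V // x ∉ S.image some} where
  toFun
    | none => ⟨none, by simp⟩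
    | some v => ⟨some v.1, by simpa using v.2⟩
  invFun
    | ⟨none, _⟩ => none
    | ⟨some v, h⟩ => some ⟨v, by simpa using h⟩
  left_inv i := by rcases i with _ | v <;> rfl
  right_inv i := by rcases i with ⟨_ | v, h⟩ <;> rfl

theorem submatrix_lapStarSG_eq_starMatrix_sub (G : SimpleGraph V) [DecidableRel G.Adj]
    (hreg : G.IsRegularOfDegree 3) (S : Finset V) :
    ((lapStarSG G).submatrix
        (Subtype.val : {x : Option V // x ∉ S.image some} → Option V) Subtype.val).submatrix
        (optionNotMemEquiv S) (optionNotMemEquiv S) =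
      starMatrix (Fintype.card V : ℝ) -
        extendByZero ((G.adjMatrix ℝ).submatrix
          (Subtype.val : {v : V // v ∉ S} → V) Subtype.val) := by
  ext i j
  rcases i with _ | u <;> rcases j with _ | v <;>
    simp [lapStarSG, optionNotMemEquiv, starMatrix, extendByZero, SimpleGraph.lapMatrix,
      SimpleGraph.degMatrix, diagonal_apply, hreg.degree_eq, one_apply, Subtype.ext_iff]
  split_ifs <;> norm_num

theorem sum_adjMatrix_submatrix_le_degree (G : SimpleGraph V) [DecidableRel G.Adj]
    (S : Finset V) (u : V) :
    ∑ v : {v : V // v ∉ S}, G.adjMatrix ℝ u v ≤ G.degree u := by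
  have h : ∑ v, G.adjMatrix ℝ u v = G.degree u := by
    simp [← SimpleGraph.card_neighborFinset_eq_degree, SimpleGraph.neighborFinset_eq_filter]
  rw [← h, ← Finset.sum_subtype Sᶜ (by simp) fun v => G.adjMatrix ℝ u v]
  refine Finset.sum_le_sum_of_subset_of_nonneg (Finset.subset_univ _) fun v _ _ => ?_
  rw [SimpleGraph.adjMatrix_apply]
  split_ifs <;> norm_num

end Grounded

/-- let `G` be a connected unweighted 3-regular simple graph on `n` vertices,
let `L_star` be the Laplacian of the augmented graph `G_star` (with `α = 1`), and let
`S ⊂ V` be nonempty with `|S| = k`. Then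
`trace((L_star_{-S})⁻¹) ≥ 4/(3n + k) + (1/4 + 1/(4(3n + k)))·(n - k)`, with equality
if and only if `S` is a vertex cover of `G`. -/
theorem trace_inv_grounded_lapStar_ge_of_threeRegular
    (G : SimpleGraph V) [DecidableRel G.Adj] (hconn : G.Connected)
    (hreg : G.IsRegularOfDegree 3) (S : Finset V) (hS : S.Nonempty)
    (hSV : S ⊂ Finset.univ) :
    4 / (3 * (Fintype.card V : ℝ) + S.card)
        + (1 / 4 + 1 / (4 * (3 * (Fintype.card V : ℝ) + S.card)))
          * ((Fintype.card V : ℝ) - S.card)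
      ≤ Matrix.trace (((lapStarSG G).submatrix
          (Subtype.val : {x : Option V // x ∉ S.image some} → Option V) Subtype.val)⁻¹) ∧
    (Matrix.trace (((lapStarSG G).submatrix
          (Subtype.val : {x : Option V // x ∉ S.image some} → Option V) Subtype.val)⁻¹)
        = 4 / (3 * (Fintype.card V : ℝ) + S.card)
          + (1 / 4 + 1 / (4 * (3 * (Fintype.card V : ℝ) + S.card)))
            * ((Fintype.card V : ℝ) - S.card)
      ↔ ∀ u v : V, G.Adj u v → u ∈ S ∨ v ∈ S) := by
  have hcard : (Fintype.card {v : V // v ∉ S} : ℝ) = Fintype.card V - S.card := by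
    rw [Fintype.card_subtype_compl, Fintype.card_coe, Nat.cast_sub S.card_le_univ]
  have hk : (0 : ℝ) < S.card := by exact_mod_cast hS.card_pos
  have hden : (0 : ℝ) < 3 * (Fintype.card V : ℝ) + S.card := by positivity
  set c : ℝ := 4 / (3 * (Fintype.card V : ℝ) + S.card) with hc
  have hc0 : 0 < c := by positivity
  set A : Matrix {v : V // v ∉ S} {v : V // v ∉ S} ℝ :=
    (G.adjMatrix ℝ).submatrix Subtype.val Subtype.val with hAdef
  have hA : A.IsSymm := G.isSymm_adjMatrix.submatrix _
  have hA0 : ∀ i j, 0 ≤ A i j := fun i j => by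
    simp only [hAdef, submatrix_apply, SimpleGraph.adjMatrix_apply]
    split_ifs <;> norm_num
  have hd : ∀ i, ∑ j, A i j ≤ 3 := fun i => by
    have h := sum_adjMatrix_submatrix_le_degree G S i
    rw [hreg.degree_eq] at h
    exact_mod_cast h
  have hE0 : ∀ i j, 0 ≤ extendByZero A i j := fun i j => by
    rcases i with _ | u <;> rcases j with _ | v <;> simp [extendByZero, hA0]
  have hmul : starMatrix (Fintype.card V : ℝ) * starMatrixInv c =
      (1 : Matrix (Option {v : V // v ∉ S}) _ ℝ) :=
    starMatrix_mul_starMatrixInv (by rw [hcard, hc]; field_simp; ring)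
  have hpos : (starMatrix (Fintype.card V : ℝ) - extendByZero A).PosDef :=
    posDef_starMatrix_sub_extendByZero hA hA0 hd (by rw [hcard]; linarith)
  have htrace : Matrix.trace (((lapStarSG G).submatrix
      (Subtype.val : {x : Option V // x ∉ S.image some} → Option V) Subtype.val)⁻¹) =
      (starMatrix (Fintype.card V : ℝ) - extendByZero A)⁻¹.trace := by
    rw [← submatrix_lapStarSG_eq_starMatrix_sub G hreg S, inv_submatrix_equiv]
    exact (Equiv.sum_comp (optionNotMemEquiv S) _).symm
  have hbound : c + (1 / 4 + 1 / (4 * (3 * (Fintype.card V : ℝ) + S.card)))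
      * ((Fintype.card V : ℝ) - S.card) =
      (starMatrixInv c : Matrix (Option {v : V // v ∉ S}) _ ℝ).trace := by
    rw [trace_starMatrixInv, hcard, hc]
    field_simp
    ring
  have hle := trace_add_trace_le_trace_inv_sub hmul (starMatrixInv_isSymm c)
    (extendByZero_isSymm hA) hpos
  have hnonneg := trace_mul_mul_nonneg
    (starMatrixInv_pos (W := {v : V // v ∉ S}) hc0) hE0
  rw [htrace, hbound]
  refine ⟨by linarith, fun heq u v huv => ?_, fun hcover => ?_⟩
  · have hzero := eq_zero_of_trace_mul_mul_nonpos (starMatrixInv_pos hc0) hE0 (by linarith)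
    by_contra! hmem
    have h := congrFun₂ hzero (some ⟨u, hmem.1⟩) (some ⟨v, hmem.2⟩)
    simp [extendByZero, hAdef, huv] at h
  · have hzero : extendByZero A = 0 := by
      ext i j
      rcases i with _ | u <;> rcases j with _ | v <;> simp [extendByZero, hAdef]
      exact fun huv => (hcover _ _ huv).elim u.2 v.2
    rw [hzero, sub_zero, inv_eq_right_inv hmul]
end

section
/- The group forest farness f(S) = trace((L_star_{−S})^{-1}) is supermodular: for all nonempty subsets S ⊆ T ⊆ V and every vertex v ∈ V ∖ T, the marginal decrease satisfies f(S) − f(S ∪ {v}) ≥ f(T) − f(T ∪ {v}). -/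
open Matrix

variable {V : Type*} [Fintype V] [DecidableEq V]

/-- The group forest farness `f(S) = trace((L_star_{-S})⁻¹)`, where `L_star_{-S}` is the
principal submatrix of `L_star` obtained by deleting all rows and columns with indices
in `S` (the universal vertex is never deleted). -/
noncomputable def gff (α : ℝ) (W : Matrix V V ℝ) (S : Finset V) : ℝ :=
  Matrix.trace (((lapStar α W).submatrix
    (Subtype.val : {x : Option V // x ∉ S.image some} → Option V) Subtype.val)⁻¹)

section Green

variable {ι : Type*} [Fintype ι]

/-- The minimum principle for `L` with boundary `S`: a function that is nonnegative on `S` and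
`L`-superharmonic off `S` is nonnegative. -/
def MinPrinciple (L : Matrix ι ι ℝ) (S : Finset ι) : Prop :=
  ∀ g : ι → ℝ, (∀ i ∈ S, 0 ≤ g i) → (∀ i ∉ S, 0 ≤ (L *ᵥ g) i) → ∀ i, 0 ≤ g i

/-- A matrix with nonpositive off-diagonal entries, zero row sums, and a vertex `r` adjacent to all
others satisfies the minimum principle for every nonempty boundary. -/
theorem minPrinciple_of_universal {L : Matrix ι ι ℝ} (hoff : ∀ i j, i ≠ j → L i j ≤ 0)
    (hrow : ∀ i, ∑ j, L i j = 0) (r : ι) (hr : ∀ j, j ≠ r → L r j < 0 ∧ L j r < 0)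
    {S : Finset ι} (hS : S.Nonempty) : MinPrinciple L S := by
  intro g hgS hg
  obtain ⟨s, hs⟩ := hS
  obtain ⟨m, -, hm⟩ := Finset.exists_min_image Finset.univ g ⟨s, Finset.mem_univ s⟩
  have hmin : ∀ i, g m ≤ g i := fun i => hm i (Finset.mem_univ i)
  by_contra! hneg
  obtain ⟨i₀, hi₀⟩ := hneg
  -- a negative minimum propagates to all neighbours
  have spread : ∀ a, g a = g m → ∀ b, L a b < 0 → g b = g m := by
    intro a ha b hab
    have haS : a ∉ S := fun h => by linarith [hgS a h, hmin i₀]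
    have hsum : (L *ᵥ g) a = ∑ j, L a j * (g j - g m) := by
      simp only [mulVec, dotProduct, mul_sub, Finset.sum_sub_distrib, ← Finset.sum_mul, hrow a]
      simp
    have hterm : ∀ j ∈ Finset.univ, L a j * (g j - g m) ≤ 0 := by
      intro j _
      by_cases hj : a = j
      · subst hj; simp [ha]
      · exact mul_nonpos_of_nonpos_of_nonneg (hoff a j hj) (by linarith [hmin j])
    have hzero : ∑ j, L a j * (g j - g m) = 0 :=
      le_antisymm (Finset.sum_nonpos hterm) (hsum ▸ hg a haS)
    have hb := (Finset.sum_eq_zero_iff_of_nonpos hterm).1 hzero b (Finset.mem_univ b)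
    rcases mul_eq_zero.1 hb with h | h <;> linarith
  have hroot : g r = g m := by
    by_cases h : m = r
    · rw [h]
    · exact spread m rfl r (hr m h).2
  have hsm : g s = g m := by
    by_cases h : s = r
    · rw [h, hroot]
    · exact spread r hroot s (hr s h).1
  linarith [hgS s hs, hmin i₀]

theorem MinPrinciple.le {L : Matrix ι ι ℝ} {S : Finset ι} (hL : MinPrinciple L S) {g k : ι → ℝ}
    (hS : ∀ i ∈ S, g i ≤ k i) (hLgk : ∀ i ∉ S, (L *ᵥ g) i ≤ (L *ᵥ k) i) (i : ι) : g i ≤ k i := by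
  have := hL (k - g) (fun i hi => by simpa using hS i hi)
    (fun i hi => by simpa [mulVec_sub] using hLgk i hi) i
  simpa using this

theorem MinPrinciple.eq {L : Matrix ι ι ℝ} {S : Finset ι} (hL : MinPrinciple L S) {g k : ι → ℝ}
    (hS : ∀ i ∈ S, g i = k i) (hLgk : ∀ i ∉ S, (L *ᵥ g) i = (L *ᵥ k) i) (i : ι) : g i = k i :=
  le_antisymm (hL.le (fun i hi => (hS i hi).le) (fun i hi => (hLgk i hi).le) i)
    (hL.le (fun i hi => (hS i hi).ge) (fun i hi => (hLgk i hi).ge) i)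

variable [DecidableEq ι]

/-- The principal submatrix of `L` obtained by deleting the rows and columns in `S`. -/
abbrev principalMinor (L : Matrix ι ι ℝ) (S : Finset ι) :
    Matrix {x : ι // x ∉ S} {x : ι // x ∉ S} ℝ :=
  L.submatrix Subtype.val Subtype.val

/-- The Green function of `L` with Dirichlet boundary `S`: the inverse of the principal submatrix
off `S`, extended by zero. -/
noncomputable def green (L : Matrix ι ι ℝ) (S : Finset ι) (i j : ι) : ℝ :=
  if h : i ∉ S ∧ j ∉ S then (principalMinor L S)⁻¹ ⟨i, h.1⟩ ⟨j, h.2⟩ else 0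

/-- Applying `L` to a function vanishing on `S` agrees off `S` with applying the minor. -/
theorem mulVec_eq_sum_compl (L : Matrix ι ι ℝ) {S : Finset ι} {g : ι → ℝ}
    (hg : ∀ i ∈ S, g i = 0) (i : ι) :
    (L *ᵥ g) i = ∑ x : {x : ι // x ∉ S}, L i x * g x := by
  rw [mulVec, dotProduct, ← Finset.sum_subtype Sᶜ (by simp) (fun x => L i x * g x)]
  refine (Finset.sum_subset (Finset.subset_univ _) fun x _ hx => ?_).symm
  rw [hg x (by simpa using hx), mul_zero]

theorem MinPrinciple.isUnit {L : Matrix ι ι ℝ} {S : Finset ι} (hL : MinPrinciple L S) :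
    IsUnit (principalMinor L S) := by
  rw [← mulVec_injective_iff_isUnit]
  intro a b hab
  have hext : ∀ c : {x : ι // x ∉ S} → ℝ, ∀ i : {x : ι // x ∉ S},
      (L *ᵥ fun j => if h : j ∉ S then c ⟨j, h⟩ else 0) i = (principalMinor L S *ᵥ c) i := by
    intro c i
    rw [mulVec_eq_sum_compl L (S := S) (fun j hj => by simp [hj])]
    refine Finset.sum_congr rfl fun x _ => ?_
    simp [x.2]
  funext i
  have := hL.eq (g := fun j => if h : j ∉ S then a ⟨j, h⟩ else 0)
    (k := fun j => if h : j ∉ S then b ⟨j, h⟩ else 0) (fun j hj => by simp [hj])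
    (fun j hj => by rw [hext a ⟨j, hj⟩, hext b ⟨j, hj⟩]; exact congrFun hab _) i
  simpa [i.2] using this

theorem green_eq_zero_left (L : Matrix ι ι ℝ) {S : Finset ι} {i : ι} (hi : i ∈ S) (j : ι) :
    green L S i j = 0 := by
  simp [green, hi]

theorem green_eq_zero_right (L : Matrix ι ι ℝ) {S : Finset ι} (i : ι) {j : ι} (hj : j ∈ S) :
    green L S i j = 0 := by
  simp [green, hj]

theorem trace_inv_principalMinor (L : Matrix ι ι ℝ) (S : Finset ι) :
    ((principalMinor L S)⁻¹).trace = ∑ i, green L S i i := by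
  have h : ((principalMinor L S)⁻¹).trace = ∑ x : {x : ι // x ∉ S}, green L S x x :=
    Finset.sum_congr rfl fun x _ => by simp [green, x.2]
  rw [h, ← Finset.sum_subtype Sᶜ (by simp) (fun x => green L S x x)]
  refine Finset.sum_subset (Finset.subset_univ _) fun x _ hx => ?_
  exact green_eq_zero_left L (by simpa using hx) x

theorem MinPrinciple.mulVec_green {L : Matrix ι ι ℝ} {S : Finset ι} (hL : MinPrinciple L S)
    {i j : ι} (hi : i ∉ S) (hj : j ∉ S) :
    (L *ᵥ fun k => green L S k j) i = if i = j then 1 else 0 := by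
  rw [mulVec_eq_sum_compl L (S := S) (fun k hk => green_eq_zero_left L hk j)]
  have hmul := mul_nonsing_inv (principalMinor L S) ((isUnit_iff_isUnit_det _).1 hL.isUnit)
  have := congrFun (congrFun hmul ⟨i, hi⟩) ⟨j, hj⟩
  simp only [mul_apply, one_apply, Subtype.mk.injEq] at this
  rw [← this]
  refine Finset.sum_congr rfl fun x _ => ?_
  simp [green, x.2, hj]

theorem MinPrinciple.green_nonneg {L : Matrix ι ι ℝ} {S : Finset ι} (hL : MinPrinciple L S)
    (i j : ι) : 0 ≤ green L S i j := by
  by_cases hj : j ∈ S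
  · rw [green_eq_zero_right L i hj]
  · refine hL (fun k => green L S k j) (fun k hk => (green_eq_zero_left L hk j).ge)
      (fun k hk => ?_) i
    rw [hL.mulVec_green hk hj]
    split_ifs <;> norm_num

theorem MinPrinciple.green_self_pos {L : Matrix ι ι ℝ} (hoff : ∀ i j, i ≠ j → L i j ≤ 0)
    {S : Finset ι} (hL : MinPrinciple L S) {v : ι} (hv : v ∉ S) : 0 < green L S v v := by
  refine lt_of_le_of_ne (hL.green_nonneg v v) fun h0 => ?_
  have h1 := hL.mulVec_green hv hv
  rw [if_pos rfl] at h1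
  have : (L *ᵥ fun k => green L S k v) v ≤ 0 := by
    refine Finset.sum_nonpos fun k _ => ?_
    by_cases hk : v = k
    · subst hk; simp [← h0]
    · exact mul_nonpos_of_nonpos_of_nonneg (hoff v k hk) (hL.green_nonneg k v)
  linarith

/-- Green functions decrease when the boundary grows. -/
theorem green_anti {L : Matrix ι ι ℝ} {S T : Finset ι} (hS : MinPrinciple L S)
    (hT : MinPrinciple L T) (hST : S ⊆ T) (i j : ι) : green L T i j ≤ green L S i j := by
  by_cases hj : j ∈ T
  · rw [green_eq_zero_right L i hj]; exact hS.green_nonneg i j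
  · refine hT.le (g := fun k => green L T k j) (k := fun k => green L S k j)
      (fun k hk => ?_) (fun k hk => ?_) i
    · simp only [green_eq_zero_left L hk]; exact hS.green_nonneg k j
    · rw [hT.mulVec_green hk hj, hS.mulVec_green (fun h => hk (hST h)) (fun h => hj (hST h))]

/-- The equilibrium potential of `v` relative to `S`: the `L`-harmonic function off `insert v S`
with value `1` at `v` and `0` on `S`. -/
noncomputable def potential (L : Matrix ι ι ℝ) (S : Finset ι) (v i : ι) : ℝ :=
  (green L S v v)⁻¹ * green L S i v

theorem MinPrinciple.mulVec_potential {L : Matrix ι ι ℝ} {S : Finset ι} (hL : MinPrinciple L S)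
    {v i : ι} (hv : v ∉ S) (hi : i ∉ insert v S) : (L *ᵥ potential L S v) i = 0 := by
  rw [Finset.mem_insert, not_or] at hi
  have : potential L S v = (green L S v v)⁻¹ • fun k => green L S k v := rfl
  rw [this, mulVec_smul, Pi.smul_apply, hL.mulVec_green hi.2 hv, if_neg hi.1, smul_zero]

theorem potential_of_mem (L : Matrix ι ι ℝ) {S : Finset ι} (v : ι) {i : ι} (hi : i ∈ S) :
    potential L S v i = 0 := by
  rw [potential, green_eq_zero_left L hi, mul_zero]

theorem MinPrinciple.potential_nonneg {L : Matrix ι ι ℝ} {S : Finset ι} (hL : MinPrinciple L S)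
    (v i : ι) : 0 ≤ potential L S v i :=
  mul_nonneg (inv_nonneg.2 (hL.green_nonneg v v)) (hL.green_nonneg i v)

theorem MinPrinciple.potential_self {L : Matrix ι ι ℝ} (hoff : ∀ i j, i ≠ j → L i j ≤ 0)
    {S : Finset ι} (hL : MinPrinciple L S) {v : ι} (hv : v ∉ S) : potential L S v v = 1 :=
  inv_mul_cancel₀ (ne_of_gt (hL.green_self_pos hoff hv))

/-- Equilibrium potentials decrease when the boundary grows. -/
theorem potential_anti {L : Matrix ι ι ℝ} (hoff : ∀ i j, i ≠ j → L i j ≤ 0) {S T : Finset ι}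
    {v : ι} (hS : MinPrinciple L S) (hT : MinPrinciple L T) (hTv : MinPrinciple L (insert v T))
    (hST : S ⊆ T) (hv : v ∉ T) (i : ι) : potential L T v i ≤ potential L S v i := by
  have hvS : v ∉ S := fun h => hv (hST h)
  refine hTv.le (fun k hk => ?_) (fun k hk => ?_) i
  · rcases Finset.mem_insert.1 hk with rfl | hk
    · rw [hT.potential_self hoff hv, hS.potential_self hoff hvS]
    · rw [potential_of_mem L v hk]; exact hS.potential_nonneg v k
  · rw [hT.mulVec_potential hv hk,
      hS.mulVec_potential hvS fun h => hk (Finset.insert_subset_insert v hST h)]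

/-- The change of the Green function when one vertex joins the boundary. -/
theorem green_eq_green_insert_add {L : Matrix ι ι ℝ} (hoff : ∀ i j, i ≠ j → L i j ≤ 0)
    {S : Finset ι} {v : ι} (hS : MinPrinciple L S) (hSv : MinPrinciple L (insert v S))
    (hv : v ∉ S) (i j : ι) :
    green L S i j = green L (insert v S) i j + green L S v j * potential L S v i := by
  by_cases hj : j ∈ S
  · simp [green_eq_zero_right L _ hj, green_eq_zero_right L i (Finset.mem_insert_of_mem hj)]
  by_cases hjv : j = v
  · subst hjv
    rw [green_eq_zero_right L i (Finset.mem_insert_self j S), potential,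
      mul_inv_cancel_left₀ (hS.green_self_pos hoff hv).ne', zero_add]
  refine hSv.eq (g := fun k => green L S k j)
    (k := (fun k => green L (insert v S) k j) + green L S v j • potential L S v)
    (fun k hk => ?_) (fun k hk => ?_) i
  · simp only [Pi.add_apply, Pi.smul_apply, smul_eq_mul, green_eq_zero_left L hk]
    rcases Finset.mem_insert.1 hk with rfl | hk
    · rw [hS.potential_self hoff hv]; ring
    · rw [potential_of_mem L v hk, green_eq_zero_left L hk]; ring
  · rw [mulVec_add, mulVec_smul, Pi.add_apply, Pi.smul_apply, hS.mulVec_potential hv hk,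
      hSv.mulVec_green hk (by simp [hj, hjv]),
      hS.mulVec_green (fun h => hk (Finset.mem_insert_of_mem h)) hj, smul_zero, add_zero]

/-- The trace of the inverse of the principal submatrix off `S` is supermodular in `S`. -/
theorem trace_inv_principalMinor_supermodular {L : Matrix ι ι ℝ}
    (hoff : ∀ i j, i ≠ j → L i j ≤ 0) (hL : ∀ S : Finset ι, S.Nonempty → MinPrinciple L S)
    {S T : Finset ι} (hS : S.Nonempty) (hST : S ⊆ T) {v : ι} (hv : v ∉ T) :
    ((principalMinor L T)⁻¹).trace - ((principalMinor L (insert v T))⁻¹).trace ≤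
      ((principalMinor L S)⁻¹).trace - ((principalMinor L (insert v S))⁻¹).trace := by
  have hLS := hL S hS
  have hLT := hL T (hS.mono hST)
  have hLSv := hL _ (Finset.insert_nonempty v S)
  have hLTv := hL _ (Finset.insert_nonempty v T)
  simp only [trace_inv_principalMinor, ← Finset.sum_sub_distrib]
  refine Finset.sum_le_sum fun i _ => ?_
  rw [green_eq_green_insert_add hoff hLT hLTv hv i i,
    green_eq_green_insert_add hoff hLS hLSv (fun h => hv (hST h)) i i,
    add_sub_cancel_left, add_sub_cancel_left]
  exact mul_le_mul (green_anti hLS hLT hST v i) (potential_anti hoff hLS hLT hLTv hST hv i)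
    (hLT.potential_nonneg v i) (hLS.green_nonneg v i)

end Green

theorem lapStar_off_diag_nonpos {W : Matrix V V ℝ} (hnn : ∀ u v, 0 ≤ W u v) {α : ℝ} (hα : 0 < α)
    (i j : Option V) (hij : i ≠ j) : lapStar α W i j ≤ 0 := by
  rcases i with _ | u <;> rcases j with _ | v
  · exact absurd rfl hij
  · simp [lapStar]
  · simp [lapStar]
  · have huv : u ≠ v := fun h => hij (congrArg some h)
    simpa [lapStar, lap, huv] using mul_nonneg hα.le (hnn u v)

theorem sum_lapStar_row (W : Matrix V V ℝ) (α : ℝ) (i : Option V) :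
    ∑ j, lapStar α W i j = 0 := by
  rcases i with _ | u
  · simp [lapStar, Fintype.sum_option]
  · simp [lapStar, lap, Fintype.sum_option, Finset.sum_add_distrib, ← Finset.mul_sum, one_apply,
      diagonal_apply]

/-- the group forest farness `f(S) = trace((L_star_{-S})⁻¹)` is
supermodular: for all nonempty `S ⊆ T ⊆ V` and every vertex `v ∉ T`,
`f(S) - f(S ∪ {v}) ≥ f(T) - f(T ∪ {v})`. -/
theorem gff_supermodular
    (W : Matrix V V ℝ) (hsym : ∀ u v, W u v = W v u) (hnn : ∀ u v, 0 ≤ W u v)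
    (hdiag : ∀ v, W v v = 0)
    (hconn : (SimpleGraph.fromRel fun a b => W a b ≠ 0).Connected)
    (α : ℝ) (hα : 0 < α) (S T : Finset V) (hS : S.Nonempty) (hST : S ⊆ T)
    (v : V) (hv : v ∉ T) :
    gff α W T - gff α W (insert v T) ≤ gff α W S - gff α W (insert v S) := by
  have h := trace_inv_principalMinor_supermodular (L := lapStar α W)
    (lapStar_off_diag_nonpos hnn hα)
    (fun _ hR => minPrinciple_of_universal (lapStar_off_diag_nonpos hnn hα) (sum_lapStar_row W α)
      none (fun j hj => by
        rcases j with _ | u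
        · exact absurd rfl hj
        · simp [lapStar]) hR)
    (hS.image some) (Finset.image_subset_image hST) (v := some v) (by simpa using hv)
  rw [← Finset.image_insert, ← Finset.image_insert] at h
  exact h
end
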